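/- Let A be a commutative ring, δ : A → A a derivation, and Q₀, Qs, As, B ∈ A elements satisfying δ(Q₀) = B·Q₀, δ(Qs) = As + B·Qs, δ(As) = 0 and δ(B) = 0. Then for every integer m ≥ 1, the m-th iterate of the map T : A → A, T(f) = Q₀·δ(f), satisfies T^m(Qs) = m!·Q₀^m·(B^m·Qs + B^{m−1}·As), where m! is the factorial of m (cast into A via the natural-number action). -/

import Mathlib

/-- The relation `δ q = b·q` propagates to powers: `δ (q^n) = n·b·q^n`. -/
theorem Derivation.apply_pow_of_apply_eq_mul {R A : Type*} [CommRing R] [CommRing A] [Algebra R A]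
    (δ : Derivation R A A) {q b : A} (h : δ q = b * q) (n : ℕ) :
    δ (q ^ n) = n * b * q ^ n := by
  induction n with
  | zero => simp
  | succ n ih =>
    rw [pow_succ, Derivation.leibniz, ih, h]
    simp only [smul_eq_mul]
    push_cast
    ring

/-- Closed form for the iterates of `T : f ↦ Q₀·δ(f)`:
if `δ Q₀ = B·Q₀`, `δ Qs = As + B·Qs`, `δ As = 0` and `δ B = 0`, then
`T^m(Qs) = m!·Q₀^m·(B^m·Qs + B^{m−1}·As)` for all `m ≥ 1`. -/
theorem stmt_3 {A : Type*} [CommRing A] (δ : Derivation ℤ A A) (Q₀ Qs As B : A)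
    (hQ₀ : δ Q₀ = B * Q₀) (hQs : δ Qs = As + B * Qs) (hAs : δ As = 0) (hB : δ B = 0) :
    ∀ m : ℕ, 1 ≤ m →
      (fun f => Q₀ * δ f)^[m] Qs
        = m.factorial • (Q₀ ^ m * (B ^ m * Qs + B ^ (m - 1) * As)) := by
  have hBpow (n : ℕ) : δ (B ^ n) = 0 := by simp [Derivation.leibniz_pow, hB]
  intro m hm
  induction m, hm using Nat.le_induction with
  | base => simp [hQs, add_comm]
  | succ m hm ih =>
    obtain ⟨k, rfl⟩ := Nat.exists_eq_add_of_le' hm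
    rw [Function.iterate_succ_apply', ih]
    simp only [Derivation.map_natCast, Derivation.leibniz, map_add, hBpow, hAs, hQs,
      δ.apply_pow_of_apply_eq_mul hQ₀, smul_eq_mul, nsmul_eq_mul, Nat.add_sub_cancel,
      Nat.factorial_succ (k + 1)]
    push_cast
    ring
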